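/- arXiv:1305.1174 — 2 statements merged into one kernel-verified Lean document; each statement's English description precedes it below -/
import Mathlib

section
/- Let L be a K-Lie subalgebra of Der_K(R) of finite rank over R, Z = Z(L) its center, and F = F(L) its field of constants. Then rk_R(Z) = dim_F(span_F Z), and span_F(Z) is contained in the center of the Lie algebra FL = span_F(L). In particular, if L is abelian, then FL is an abelian Lie subalgebra of Der_K(R) and rk_R(L) = dim_F(FL). -/
/-!
Setting: `K` is a field, `R` is a field extension of `K` (in the paper, `R` is the
quotient field of an integral `K`-domain `A`).  `Derivation K R R` is the Lie algebra
`Der_K(R)` of all `K`-derivations of `R`; it is an `R`-vector space and a Lie algebra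
over `K`.
-/

variable {K R : Type*} [Field K] [Field R] [Algebra K R]

/-- The field of constants `F(L) = {r ∈ R : D r = 0 for all D ∈ L}` of a
`K`-Lie subalgebra `L` of `Der_K(R)`. -/
def constField (L : LieSubalgebra K (Derivation K R R)) : Subfield R where
  carrier := {r : R | ∀ D ∈ L, D r = 0}
  zero_mem' := fun D _ => map_zero D
  one_mem' := fun D _ => D.map_one_eq_zero
  add_mem' := fun {a b} ha hb D hD => by rw [map_add, ha D hD, hb D hD, add_zero]
  mul_mem' := fun {a b} ha hb D hD => by
    rw [D.leibniz, ha D hD, hb D hD, smul_zero, smul_zero, add_zero]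
  neg_mem' := fun {a} ha D hD => by rw [map_neg, ha D hD, neg_zero]
  inv_mem' := fun a ha D hD => by rw [D.leibniz_inv, ha D hD, smul_zero]

theorem lie_smul_derivation (D E : Derivation K R R) (r : R) :
    ⁅D, r • E⁆ = D r • E + r • ⁅D, E⁆ := by
  ext a
  simp only [Derivation.commutator_apply, Derivation.smul_apply, Derivation.add_apply,
    Derivation.leibniz, smul_eq_mul]
  ring

/-- A family of derivations commuting with `L` that is linearly independent over the field of
constants of `L` is linearly independent over `R`. -/
theorem LinearIndependent.of_constField {L : LieSubalgebra K (Derivation K R R)} {ι : Type*}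
    {v : ι → Derivation K R R} (hv : ∀ D ∈ L, ∀ i, ⁅D, v i⁆ = 0)
    (hF : LinearIndependent (constField L) v) : LinearIndependent R v := by
  classical
  rw [linearIndependent_iff']
  intro s
  induction s using Finset.induction_on with
  | empty => simp
  | insert a s ha ih =>
    intro g hg
    have hga : g a = 0 := by
      by_contra hga
      have hsum : ∑ i ∈ insert a s, ((g a)⁻¹ * g i) • v i = 0 := by
        simp_rw [mul_smul, ← Finset.smul_sum, hg, smul_zero]
      have hconst : ∀ i ∈ insert a s, (g a)⁻¹ * g i ∈ constField L := by
        intro i hi D hD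
        rcases Finset.mem_insert.1 hi with rfl | hi
        · rw [inv_mul_cancel₀ hga, D.map_one_eq_zero]
        · refine ih (fun j => D ((g a)⁻¹ * g j)) ?_ i hi
          have hlie : ∑ j ∈ insert a s, D ((g a)⁻¹ * g j) • v j = 0 := by
            calc ∑ j ∈ insert a s, D ((g a)⁻¹ * g j) • v j
                = ⁅D, ∑ j ∈ insert a s, ((g a)⁻¹ * g j) • v j⁆ := by
                  rw [lie_sum]
                  refine Finset.sum_congr rfl fun j _ => ?_
                  rw [lie_smul_derivation, hv D hD j, smul_zero, add_zero]
              _ = 0 := by rw [hsum, lie_zero]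
          rwa [Finset.sum_insert ha, inv_mul_cancel₀ hga, D.map_one_eq_zero, zero_smul,
            zero_add] at hlie
      have hzero := linearIndependent_iff'.1 hF (insert a s)
        (fun i => if hi : i ∈ insert a s then ⟨(g a)⁻¹ * g i, hconst i hi⟩ else 0) (by
          rw [← hsum]
          refine Finset.sum_congr rfl fun i hi => ?_
          rw [dif_pos hi]
          rfl) a (Finset.mem_insert_self a s)
      rw [dif_pos (Finset.mem_insert_self a s)] at hzero
      simpa [hga] using congrArg Subtype.val hzero
    rw [Finset.sum_insert ha, hga, zero_smul, zero_add] at hg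
    intro i hi
    rcases Finset.mem_insert.1 hi with rfl | hi
    · exact hga
    · exact ih g hg i hi

/-- The span of a set of derivations commuting with `L` has the same rank over `R` as over the
field of constants of `L`. -/
theorem rank_span_eq_rank_span_constField {L : LieSubalgebra K (Derivation K R R)}
    {S : Set (Derivation K R R)} (hS : ∀ D ∈ L, ∀ z ∈ S, ⁅D, z⁆ = 0) :
    Module.rank R (Submodule.span R S) =
      Module.rank (constField L) (Submodule.span (constField L) S) := by
  obtain ⟨b, hbS, hspan, hb⟩ := exists_linearIndependent (constField L) S
  have hR : LinearIndependent R ((↑) : b → Derivation K R R) :=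
    hb.of_constField fun D hD i => hS D hD i (hbS i.2)
  have hspanR : Submodule.span R b = Submodule.span R S := by
    refine le_antisymm (Submodule.span_mono hbS) (Submodule.span_le.2 fun x hx => ?_)
    exact Submodule.span_le_restrictScalars (constField L) R b
      (hspan ▸ Submodule.subset_span hx)
  rw [← hspanR, ← hspan, rank_span_set hR, rank_span_set hb]

/-- Elements of `span_F(L)` vanish on the field of constants of `L`. -/
theorem apply_eq_zero_of_mem_span_constField {L : LieSubalgebra K (Derivation K R R)}
    {x : Derivation K R R}
    (hx : x ∈ Submodule.span (constField L) (L : Set (Derivation K R R)))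
    {r : R} (hr : r ∈ constField L) : x r = 0 := by
  induction hx using Submodule.span_induction with
  | mem x hx => exact hr x hx
  | zero => rfl
  | add x y _ _ hx hy => rw [Derivation.add_apply, hx, hy, add_zero]
  | smul c x _ hx =>
    change (c : R) • x r = 0
    rw [hx, smul_zero]

/-- If two subsets of `L` commute, then so do their spans over the field of constants of `L`. -/
theorem lie_eq_zero_of_mem_span_constField {L : LieSubalgebra K (Derivation K R R)}
    {S T : Set (Derivation K R R)} (hS : S ⊆ L) (hT : T ⊆ L)
    (h : ∀ x ∈ S, ∀ y ∈ T, ⁅x, y⁆ = 0) {x y : Derivation K R R}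
    (hx : x ∈ Submodule.span (constField L) S) (hy : y ∈ Submodule.span (constField L) T) :
    ⁅x, y⁆ = 0 := by
  have hsmul : ∀ (c : constField L) {u w : Derivation K R R},
      u ∈ Submodule.span (constField L) (L : Set (Derivation K R R)) →
      ⁅u, w⁆ = 0 → ⁅u, c • w⁆ = 0 := by
    intro c u w hu huw
    change ⁅u, (c : R) • w⁆ = 0
    rw [lie_smul_derivation, apply_eq_zero_of_mem_span_constField hu c.2, huw, zero_smul,
      smul_zero, add_zero]
  induction hy using Submodule.span_induction with
  | zero => exact lie_zero x
  | add y z _ _ hy hz => rw [lie_add, hy, hz, add_zero]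
  | smul c y _ hy => exact hsmul c (Submodule.span_mono hS hx) hy
  | mem y hy =>
    induction hx using Submodule.span_induction with
    | mem x hx => exact h x hx y hy
    | zero => exact zero_lie y
    | add x z _ _ hx hz => rw [add_lie, hx, hz, add_zero]
    | smul c x _ hx =>
      rw [← lie_skew, hsmul c (Submodule.subset_span (hT hy)) (by rw [← lie_skew, hx, neg_zero]),
        neg_zero]

/-- Let `L` be a `K`-Lie subalgebra of `Der_K(R)` of finite rank
over `R`, `Z = Z(L)` its center and `F = F(L)` its field of constants.  Then
`rk_R(Z) = dim_F(span_F Z)` and `span_F(Z)` lies in the center of `FL = span_F(L)`.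
In particular, if `L` is abelian then `FL` is abelian and `rk_R(L) = dim_F(FL)`. -/
theorem center_rank_eq_dim_constField
    (L : LieSubalgebra K (Derivation K R R))
    [FiniteDimensional R (Submodule.span R (L : Set (Derivation K R R)))] :
    Module.rank R
        (Submodule.span R (Subtype.val '' (LieAlgebra.center K L : Set L))) =
      Module.rank (constField L)
        (Submodule.span (constField L)
          (Subtype.val '' (LieAlgebra.center K L : Set L))) ∧
    (∀ x ∈ Submodule.span (constField L)
        (Subtype.val '' (LieAlgebra.center K L : Set L)),
      x ∈ Submodule.span (constField L) (L : Set (Derivation K R R)) ∧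
      ∀ y ∈ Submodule.span (constField L) (L : Set (Derivation K R R)), ⁅x, y⁆ = 0) ∧
    (IsLieAbelian L →
      (∀ x ∈ Submodule.span (constField L) (L : Set (Derivation K R R)),
       ∀ y ∈ Submodule.span (constField L) (L : Set (Derivation K R R)),
        ⁅x, y⁆ = 0) ∧
      Module.rank R (Submodule.span R (L : Set (Derivation K R R))) =
        Module.rank (constField L)
          (Submodule.span (constField L) (L : Set (Derivation K R R)))) := by
  have hZL : Subtype.val '' (LieAlgebra.center K L : Set L) ⊆ (L : Set (Derivation K R R)) := by
    rintro _ ⟨z, -, rfl⟩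
    exact z.2
  have hLZ : ∀ D ∈ L, ∀ z ∈ Subtype.val '' (LieAlgebra.center K L : Set L), ⁅D, z⁆ = 0 := by
    rintro D hD _ ⟨z, hz, rfl⟩
    exact congrArg Subtype.val ((LieModule.mem_maxTrivSubmodule K L L z).1 hz ⟨D, hD⟩)
  refine ⟨rank_span_eq_rank_span_constField hLZ, fun x hx => ⟨Submodule.span_mono hZL hx,
    fun y hy => ?_⟩, fun hab => ?_⟩
  · rw [← lie_skew, lie_eq_zero_of_mem_span_constField subset_rfl hZL hLZ hy hx, neg_zero]
  · have hLL : ∀ x ∈ (L : Set (Derivation K R R)), ∀ y ∈ (L : Set (Derivation K R R)),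
        ⁅x, y⁆ = 0 :=
      fun x hx y hy => congrArg Subtype.val (hab.trivial ⟨x, hx⟩ ⟨y, hy⟩)
    exact ⟨fun x hx y hy => lie_eq_zero_of_mem_span_constField subset_rfl subset_rfl hLL hx hy,
      rank_span_eq_rank_span_constField hLL⟩
end

section
/- Let V be a vector space over a field K and L a finite-dimensional K-subspace of End(V) that acts nilpotently on V, i.e., L^n(V) = 0 for some n ≥ 1 (every composition of n operators from L annihilates V). If the subspace V_0 = {v ∈ V : f(v) = 0 for all f ∈ L} is finite dimensional over K, then V is finite dimensional over K. -/
/-- If the common kernel of a finite-dimensional space `L` of endomorphisms is finite-dimensional,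
then so is any subspace which `L` maps into a finite-dimensional subspace. -/
theorem Submodule.finiteDimensional_of_forall_map_le {K V : Type*} [Field K]
    [AddCommGroup V] [Module K V] (L : Submodule K (Module.End K V)) [FiniteDimensional K L]
    (h0 : FiniteDimensional K ↥(⨅ f ∈ L, LinearMap.ker f : Submodule K V))
    (S W : Submodule K V) [FiniteDimensional K W] (h : ∀ f ∈ L, S.map f ≤ W) :
    FiniteDimensional K S := by
  let φ : V →ₗ[K] L →ₗ[K] V := L.subtype.flip
  refine Module.Finite.iff_fg.mpr (Submodule.fg_of_fg_map_of_fg_inf_ker φ ?_ ?_)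
  · have hle : S.map φ ≤ LinearMap.range (LinearMap.compRight K (M := L) W.subtype) := by
      rintro _ ⟨v, hv, rfl⟩
      exact ⟨(φ v).codRestrict W fun f => h f f.2 ⟨v, hv, rfl⟩, rfl⟩
    exact Module.Finite.iff_fg.mp (Submodule.finiteDimensional_of_le hle)
  · have hle : S ⊓ LinearMap.ker φ ≤ ⨅ f ∈ L, LinearMap.ker f := by
      rintro v ⟨-, hv⟩
      simp only [Submodule.mem_iInf]
      exact fun f hf => LinearMap.congr_fun hv ⟨f, hf⟩
    exact Module.Finite.iff_fg.mp (Submodule.finiteDimensional_of_le hle)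

/-- If the common kernel of a finite-dimensional space `L` of endomorphisms is finite-dimensional,
then so is any subspace annihilated by all products of `n` elements of `L`. -/
theorem Submodule.finiteDimensional_of_le_ker_prod {K V : Type*} [Field K]
    [AddCommGroup V] [Module K V] (L : Submodule K (Module.End K V)) [FiniteDimensional K L]
    (h0 : FiniteDimensional K ↥(⨅ f ∈ L, LinearMap.ker f : Submodule K V)) (n : ℕ)
    (S : Submodule K V)
    (h : ∀ l : List (Module.End K V), l.length = n → (∀ f ∈ l, f ∈ L) →
      S ≤ LinearMap.ker l.prod) :
    FiniteDimensional K S := by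
  induction n generalizing S with
  | zero =>
    have hS : S ≤ ⊥ := fun v hv => by simpa using h [] rfl (by simp) hv
    exact Submodule.finiteDimensional_of_le hS
  | succ n ih =>
    have : FiniteDimensional K ↥(⨆ f ∈ L, S.map f) := by
      refine ih _ fun l hl hlL => iSup₂_le fun f hf => ?_
      rintro _ ⟨v, hv, rfl⟩
      have := h (l ++ [f]) (by simp [hl])
        (by simpa [or_imp, forall_and] using ⟨hlL, hf⟩) hv
      simpa using this
    exact Submodule.finiteDimensional_of_forall_map_le L h0 S _
      fun f hf => le_iSup₂_of_le f hf le_rfl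

/-- Let `V` be a vector space over a field `K` and `L` a
finite-dimensional subspace of `End(V)` acting nilpotently on `V`, i.e.
`L^n(V) = 0` for some `n ≥ 1` (every composition of `n` operators from `L`
annihilates `V`).  If `V₀ = {v ∈ V : f(v) = 0 for all f ∈ L}` is finite
dimensional, then `V` is finite dimensional. -/
theorem finiteDimensional_of_nilpotent_action (K V : Type*) [Field K]
    [AddCommGroup V] [Module K V]
    (L : Submodule K (Module.End K V)) [FiniteDimensional K L]
    (hnil : ∃ n : ℕ, 1 ≤ n ∧ ∀ f : Fin n → L, ∀ v : V,
      (List.ofFn fun i => (f i : Module.End K V)).prod v = 0)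
    (h0 : FiniteDimensional K ↥(⨅ f ∈ L, LinearMap.ker f : Submodule K V)) :
    FiniteDimensional K V := by
  obtain ⟨n, -, hn⟩ := hnil
  have : FiniteDimensional K (⊤ : Submodule K V) := by
    refine Submodule.finiteDimensional_of_le_ker_prod L h0 n ⊤ fun l hl hlL v _ => ?_
    subst hl
    simpa using hn (fun i => ⟨l.get i, hlL _ (l.get_mem i)⟩) v
  exact Module.finite_def.mpr (Module.Finite.iff_fg.mp this)
end
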